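/- arXiv:1610.01800 — 2 statements merged into one kernel-verified Lean document; each statement's English description precedes it below -/
import Mathlib

section
/- Let L be a modular lattice of finite height. Then L forces nilpotent type if and only if for all α, β ∈ L with α ≺ β one has Γ(α,β) = 1. -/
/-- A commutator multiplication on a complete lattice `L`: a binary operation that is
commutative, below the meet, and distributes over arbitrary joins. -/
def IsCommutatorMult {L : Type*} [CompleteLattice L] (c : L → L → L) : Prop :=
  (∀ x y : L, c x y = c y x) ∧
  (∀ x y : L, c x y ≤ x ⊓ y) ∧
  (∀ (S : Set L) (y : L), c (sSup S) y = ⨆ x ∈ S, c x y)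

/-- The residuation `(x : y)` associated with a commutator multiplication. -/
def resid {L : Type*} [CompleteLattice L] (c : L → L → L) (x y : L) : L :=
  sSup {z : L | c z y ≤ x}

/-- `[α, β] ↗ [γ, δ]`, i.e. `δ = β ⊔ γ` and `α = β ⊓ γ`. -/
def TransUp {L : Type*} [Lattice L] (p q : L × L) : Prop :=
  q.2 = p.2 ⊔ q.1 ∧ p.1 = p.2 ⊓ q.1

/-- Projectivity of intervals: the equivalence relation generated by `↗`. -/
def ProjIntv {L : Type*} [Lattice L] : L × L → L × L → Prop :=
  Relation.EqvGen TransUp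

/-- `η⁺ = ⋀ { β | η < β }`. -/
def mplus {L : Type*} [CompleteLattice L] (η : L) : L := sInf {β : L | η < β}

/-- `ρ⁻ = ⋁ { α | α < ρ }`. -/
def jminus {L : Type*} [CompleteLattice L] (ρ : L) : L := sSup {α : L | α < ρ}

/-- `η` is meet irreducible if `η < η⁺`. -/
def MeetIrred {L : Type*} [CompleteLattice L] (η : L) : Prop := η < mplus η

/-- `ρ` is join irreducible if `ρ⁻ < ρ`. -/
def JoinIrred {L : Type*} [CompleteLattice L] (ρ : L) : Prop := jminus ρ < ρ

/-- `Γ(α,β) = ⋁ { η ∈ M(L) | [η,η⁺] ⟷ [α,β] }`. -/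
def GammaEl {L : Type*} [CompleteLattice L] (α β : L) : L :=
  sSup {η : L | MeetIrred η ∧ ProjIntv (η, mplus η) (α, β)}

/-- `Δ(α,β) = ⋁ { ρ ∈ J(L) | [ρ⁻,ρ] ⟷ [α,β] }`. -/
def DeltaEl {L : Type*} [CompleteLattice L] (α β : L) : L :=
  sSup {ρ : L | JoinIrred ρ ∧ ProjIntv (jminus ρ, ρ) (α, β)}

/-- A lonesome meet irreducible element. -/
def LonesomeMeet {L : Type*} [CompleteLattice L] (η : L) : Prop :=
  MeetIrred η ∧ ∀ φ : L, MeetIrred φ → ProjIntv (φ, mplus φ) (η, mplus η) → φ = η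

/-- A lonesome join irreducible element. -/
def LonesomeJoin {L : Type*} [CompleteLattice L] (ρ : L) : Prop :=
  JoinIrred ρ ∧ ∀ σ : L, JoinIrred σ → ProjIntv (jminus σ, σ) (jminus ρ, ρ) → σ = ρ

/-- The interval `[a,b]` projects into the interval `[c,d]`. -/
def ProjInto {L : Type*} [CompleteLattice L] (a b c d : L) : Prop :=
  ∃ a₁ b₁ : L, c ≤ a₁ ∧ a₁ ≤ b₁ ∧ b₁ ≤ d ∧ ProjIntv (a, b) (a₁, b₁)

/-- A complete congruence on a complete lattice. -/
def IsCompleteCongruence {L : Type*} [CompleteLattice L] (Θ : L → L → Prop) : Prop :=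
  Equivalence Θ ∧
  ∀ S : Set (L × L), (∀ p ∈ S, Θ p.1 p.2) →
    Θ (⨆ p ∈ S, p.1) (⨆ p ∈ S, p.2) ∧ Θ (⨅ p ∈ S, p.1) (⨅ p ∈ S, p.2)

/-- The largest commutator operation `⌊x,y⌋` on a complete lattice. -/
def lcomm {L : Type*} [CompleteLattice L] (x y : L) : L :=
  sSup {z : L | ∃ c : L → L → L, IsCommutatorMult c ∧ z = c x y}

/-- The derived series `γ₁ = 1, γ_{n+1} = [γ_n, γ_n]` (indexed from 0). -/
def derivedSeq {L : Type*} [CompleteLattice L] (c : L → L → L) : ℕ → L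
  | 0 => ⊤
  | n + 1 => c (derivedSeq c n) (derivedSeq c n)

/-- The lower central series `λ₁ = 1, λ_{n+1} = [1, λ_n]` (indexed from 0). -/
def lowerCentralSeq {L : Type*} [CompleteLattice L] (c : L → L → L) : ℕ → L
  | 0 => ⊤
  | n + 1 => c ⊤ (lowerCentralSeq c n)

/-- A commutator lattice is of solvable type if its derived series reaches `0`. -/
def SolvableType {L : Type*} [CompleteLattice L] (c : L → L → L) : Prop :=
  ∃ n, derivedSeq c n = ⊥

/-- A commutator lattice is of nilpotent type if its lower central series reaches `0`. -/
def NilpotentType {L : Type*} [CompleteLattice L] (c : L → L → L) : Prop :=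
  ∃ n, lowerCentralSeq c n = ⊥

/-- `L` forces abelian type if `⌊1,1⌋ = 0`. -/
def ForcesAbelianType (L : Type*) [CompleteLattice L] : Prop := lcomm (⊤ : L) ⊤ = ⊥

/-- `L` forces nilpotent type. -/
def ForcesNilpotentType (L : Type*) [CompleteLattice L] : Prop :=
  NilpotentType (lcomm : L → L → L)

/-- `L` forces solvable type. -/
def ForcesSolvableType (L : Type*) [CompleteLattice L] : Prop :=
  SolvableType (lcomm : L → L → L)

/-- `e` realizes `L` as a complete sublattice of `K`: `e` is injective and preserves
arbitrary nonempty joins and meets. -/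
def IsCompleteSublatticeEmb {L K : Type*} [CompleteLattice L] [CompleteLattice K]
    (e : L → K) : Prop :=
  Function.Injective e ∧
  (∀ S : Set L, S.Nonempty → e (sSup S) = sSup (e '' S)) ∧
  (∀ S : Set L, S.Nonempty → e (sInf S) = sInf (e '' S))

/-- A complete lattice homomorphism: preserves arbitrary joins and arbitrary meets. -/
def IsCompleteLatticeHom {L K : Type*} [CompleteLattice L] [CompleteLattice K]
    (h : L → K) : Prop :=
  (∀ S : Set L, h (sSup S) = sSup (h '' S)) ∧
  (∀ S : Set L, h (sInf S) = sInf (h '' S))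

/-- A lattice has finite height if there is a finite bound on the lengths of its chains. -/
def FiniteHeight (L : Type*) [Preorder L] : Prop :=
  ∃ n : ℕ, ∀ l : List L, l.Chain' (· < ·) → l.length ≤ n

/-- A lattice congruence: an equivalence relation compatible with `⊔` and `⊓`. -/
def IsLatticeCongruence {L : Type*} [Lattice L] (Θ : L → L → Prop) : Prop :=
  Equivalence Θ ∧
  ∀ a b x y : L, Θ a b → Θ x y → Θ (a ⊔ x) (b ⊔ y) ∧ Θ (a ⊓ x) (b ⊓ y)

/-- A lattice is simple if its only lattice congruences are equality and the all relation. -/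
def SimpleLattice (L : Type*) [Lattice L] : Prop :=
  ∀ Θ : L → L → Prop, IsLatticeCongruence Θ →
    (∀ a b : L, Θ a b ↔ a = b) ∨ (∀ a b : L, Θ a b)

theorem FiniteHeight.exists_not_strictMono {L : Type*} [Preorder L] (h : FiniteHeight L) :
    ∃ n : ℕ, ∀ g : Fin (n + 1) → L, ¬ StrictMono g := by
  obtain ⟨n, hn⟩ := h
  refine ⟨n, fun g hg => ?_⟩
  have hchain : (List.ofFn g).IsChain (· < ·) :=
    (List.pairwise_ofFn.2 fun _ _ hij => hg hij).isChain
  have := hn _ hchain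
  simp at this

theorem FiniteHeight.wellFoundedGT {L : Type*} [Preorder L] (h : FiniteHeight L) :
    WellFoundedGT L := by
  obtain ⟨n, hn⟩ := h.exists_not_strictMono
  refine ⟨RelEmbedding.wellFounded_iff_isEmpty.2 ⟨fun f => hn (fun i => f i) ?_⟩⟩
  intro i j hij
  exact f.map_rel_iff.2 hij

theorem FiniteHeight.wellFoundedLT {L : Type*} [Preorder L] (h : FiniteHeight L) :
    WellFoundedLT L := by
  obtain ⟨n, hn⟩ := h.exists_not_strictMono
  refine ⟨RelEmbedding.wellFounded_iff_isEmpty.2 ⟨fun f => hn (fun i => f (n - i)) ?_⟩⟩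
  intro i j hij
  refine f.map_rel_iff.2 ?_
  change n - (j : ℕ) < n - (i : ℕ)
  have := j.isLt
  have : (i : ℕ) < j := hij
  omega

section CommutatorMult

variable {L : Type*} [CompleteLattice L] {c : L → L → L}

theorem IsCommutatorMult.sup_left (hc : IsCommutatorMult c) (x y z : L) :
    c (x ⊔ y) z = c x z ⊔ c y z := by
  have := hc.2.2 {x, y} z
  rwa [sSup_pair, iSup_pair] at this

theorem IsCommutatorMult.mono_right (hc : IsCommutatorMult c) (x : L) {y z : L} (h : y ≤ z) :
    c x y ≤ c x z := by
  rw [hc.1 x y, hc.1 x z, ← sup_eq_right.2 h, hc.sup_left]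
  exact le_sup_left

theorem IsCommutatorMult.sup_right (hc : IsCommutatorMult c) (x y z : L) :
    c x (y ⊔ z) = c x y ⊔ c x z := by
  rw [hc.1, hc.sup_left, hc.1 y, hc.1 z]

theorem IsCommutatorMult.le_iff_of_projIntv (hc : IsCommutatorMult c) (z : L) {p q : L × L}
    (h : ProjIntv p q) : c z p.2 ≤ p.1 ↔ c z q.2 ≤ q.1 := by
  induction h with
  | rel p q h =>
    obtain ⟨h₁, h₂⟩ := h
    rw [h₁, h₂, hc.sup_right, le_inf_iff, sup_le_iff]
    have h₃ : c z p.2 ≤ p.2 := (hc.2.1 _ _).trans inf_le_right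
    have h₄ : c z q.1 ≤ q.1 := (hc.2.1 _ _).trans inf_le_right
    tauto
  | refl => rfl
  | symm _ _ _ ih => exact ih.symm
  | trans _ _ _ _ _ ih₁ ih₂ => exact ih₁.trans ih₂

theorem IsCommutatorMult.gammaEl_le (hc : IsCommutatorMult c) (α β : L) :
    c (GammaEl α β) β ≤ α := by
  rw [GammaEl, hc.2.2]
  refine iSup₂_le fun η hη => ?_
  exact (hc.le_iff_of_projIntv η hη.2).1 ((hc.2.1 _ _).trans inf_le_left)

theorem IsCommutatorMult.le_lcomm (hc : IsCommutatorMult c) (x y : L) : c x y ≤ lcomm x y :=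
  le_sSup ⟨c, hc, rfl⟩

theorem lcomm_le_of_gammaEl_eq_top {α β : L} (h : GammaEl α β = ⊤) : lcomm ⊤ β ≤ α := by
  refine sSup_le ?_
  rintro _ ⟨c, hc, rfl⟩
  rw [← h]
  exact hc.gammaEl_le α β

theorem le_lowerCentralSeq_lcomm (hc : IsCommutatorMult c) {e : L} (he : e ≤ c ⊤ e) (n : ℕ) :
    e ≤ lowerCentralSeq lcomm n := by
  induction n with
  | zero => exact le_top
  | succ n ih => exact he.trans ((hc.mono_right ⊤ ih).trans (hc.le_lcomm _ _))

/-- A complete join endomorphism `f` below the identity whose values lie below every element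
outside the ideal of `g` yields a commutator multiplication. -/
theorem isCommutatorMult_of_join_endomorphism {f : L → L} {g : L}
    (hf : ∀ S : Set L, f (sSup S) = ⨆ x ∈ S, f x) (hle : ∀ x, f x ≤ x)
    (hg : ∀ x y, ¬ x ≤ g → f y ≤ x) :
    IsCommutatorMult fun x y => (⨆ _ : ¬ x ≤ g, f y) ⊔ ⨆ _ : ¬ y ≤ g, f x := by
  refine ⟨fun x y => sup_comm _ _, fun x y => ?_, fun S y => ?_⟩
  · exact sup_le (iSup_le fun h => le_inf (hg x y h) (hle y))
      (iSup_le fun h => le_inf (hle x) (hg y x h))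
  · apply le_antisymm
    · refine sup_le (iSup_le fun h => ?_) (iSup_le fun h => ?_)
      · obtain ⟨x, hx, hxg⟩ : ∃ x ∈ S, ¬ x ≤ g := by
          by_contra! hS
          exact h (sSup_le hS)
        exact le_iSup₂_of_le x hx (le_sup_of_le_left (le_iSup_of_le hxg le_rfl))
      · rw [hf]
        exact iSup₂_mono fun x _ => le_sup_of_le_right (le_iSup_of_le h le_rfl)
    · refine iSup₂_le fun x hx => sup_le_sup ?_ ?_
      · exact iSup_le fun h => le_iSup_of_le (fun h' => h ((le_sSup hx).trans h')) le_rfl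
      · refine iSup_mono fun _ => ?_
        rw [hf]
        exact le_iSup₂_of_le x hx le_rfl

end CommutatorMult

section Transpose

variable {L : Type*} [CompleteLattice L]

theorem exists_meetIrred_ge [WellFoundedGT L] {x ρ : L} (h : ¬ ρ ≤ x) (hx : jminus ρ ≤ x) :
    ∃ η, x ≤ η ∧ ¬ ρ ≤ η ∧ MeetIrred η ∧ TransUp (jminus ρ, ρ) (η, mplus η) := by
  obtain ⟨η, ⟨hxη, hρη⟩, hmax⟩ :=
    wellFounded_gt.has_min {η : L | x ≤ η ∧ ¬ ρ ≤ η} ⟨x, le_rfl, h⟩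
  have hgt : ∀ β, η < β → ρ ≤ β := fun β hβ => by
    by_contra hρ
    exact hmax β ⟨hxη.trans hβ.le, hρ⟩ hβ
  have hplus : mplus η = ρ ⊔ η :=
    le_antisymm (sInf_le (right_lt_sup.2 hρη))
      (le_sInf fun β hβ => sup_le (hgt β hβ) (le_of_lt hβ))
  refine ⟨η, hxη, hρη, ?_, hplus, le_antisymm ?_ ?_⟩
  · rw [MeetIrred, hplus]
    exact right_lt_sup.2 hρη
  · exact le_inf (sSup_le fun _ => le_of_lt) (hx.trans hxη)
  · exact le_sSup (inf_lt_left.2 hρη)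

theorem exists_joinIrred_le [WellFoundedLT L] {y α β : L} (hy : ¬ y ≤ α) (hyβ : y ≤ β)
    (hα : α ≤ β) (hαβ : ∀ z, α < z → z ≤ β → z = β) :
    ∃ σ ≤ y, ¬ σ ≤ α ∧ JoinIrred σ ∧ TransUp (jminus σ, σ) (α, β) := by
  obtain ⟨σ, ⟨hσy, hσα⟩, hmin⟩ :=
    wellFounded_lt.has_min {σ : L | σ ≤ y ∧ ¬ σ ≤ α} ⟨y, le_rfl, hy⟩
  have hjα : jminus σ ≤ α := sSup_le fun τ hτ => by
    by_contra h
    exact hmin τ ⟨(le_of_lt hτ).trans hσy, h⟩ hτ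
  have hjσ : jminus σ ≤ σ := sSup_le fun _ => le_of_lt
  refine ⟨σ, hσy, hσα, lt_of_le_not_ge hjσ fun h => hσα (h.trans hjα), ?_,
    le_antisymm (le_inf hjσ hjα) (le_sSup (inf_lt_left.2 hσα))⟩
  exact (hαβ _ (right_lt_sup.2 hσα) (sup_le (hσy.trans hyβ) hα)).symm

end Transpose

section ProjectiveClass

variable {L : Type*} [CompleteLattice L]

/-- The join of all join irreducible elements below `x` whose lower prime interval is projective
to `[α, β]`. -/
def jpart (α β x : L) : L :=
  sSup {ρ : L | (JoinIrred ρ ∧ ProjIntv (jminus ρ, ρ) (α, β)) ∧ ρ ≤ x}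

theorem jpart_le (α β x : L) : jpart α β x ≤ x := sSup_le fun _ h => h.2

theorem jpart_mono (α β : L) {x y : L} (h : x ≤ y) : jpart α β x ≤ jpart α β y :=
  sSup_le_sSup fun _ hρ => ⟨hρ.1, hρ.2.trans h⟩

variable [IsModularLattice L]

theorem JoinIrred.not_le_jminus_sup {ρ x : L} (hρ : JoinIrred ρ) (h : ¬ ρ ≤ x) :
    ¬ ρ ≤ jminus ρ ⊔ x := by
  intro hle
  have hmod : (jminus ρ ⊔ x) ⊓ ρ = jminus ρ ⊔ x ⊓ ρ := sup_inf_assoc_of_le x (le_of_lt hρ)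
  have hinf : x ⊓ ρ ≤ jminus ρ := le_sSup (inf_lt_right.2 h)
  rw [inf_eq_right.2 hle, sup_eq_left.2 hinf] at hmod
  exact hρ.ne' hmod

/-- A join irreducible element not below `x` transposes up to a meet irreducible above `x`. -/
theorem JoinIrred.exists_meetIrred [WellFoundedGT L] {ρ x : L} (hρ : JoinIrred ρ)
    (h : ¬ ρ ≤ x) :
    ∃ η, x ≤ η ∧ ¬ ρ ≤ η ∧ MeetIrred η ∧ TransUp (jminus ρ, ρ) (η, mplus η) := by
  obtain ⟨η, hη, hη'⟩ := exists_meetIrred_ge (hρ.not_le_jminus_sup h) le_sup_left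
  exact ⟨η, le_sup_right.trans hη, hη'⟩

theorem jpart_le_of_not_le_gammaEl [WellFoundedGT L] {α β x : L} (y : L)
    (hx : ¬ x ≤ GammaEl α β) : jpart α β y ≤ x := by
  refine sSup_le ?_
  rintro ρ ⟨⟨hρ, hP⟩, -⟩
  by_contra h
  obtain ⟨η, hxη, -, hη, ht⟩ := hρ.exists_meetIrred h
  exact hx (hxη.trans (le_sSup ⟨hη, ((Relation.EqvGen.rel _ _ ht).symm _ _).trans _ _ _ hP⟩))

theorem jpart_sSup [WellFoundedGT L] [WellFoundedLT L] (α β : L) (S : Set L) :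
    jpart α β (sSup S) = ⨆ x ∈ S, jpart α β x := by
  refine le_antisymm (sSup_le ?_) (iSup₂_le fun x hx => jpart_mono α β (le_sSup hx))
  rintro ρ ⟨⟨hρ, hP⟩, hρS⟩
  by_contra h
  obtain ⟨η, hwη, hρη, hη, ht⟩ := hρ.exists_meetIrred h
  obtain ⟨s, hs, hsη⟩ : ∃ s ∈ S, ¬ s ≤ η := by
    by_contra! hS
    exact hρη (hρS.trans (sSup_le hS))
  have hlow : ¬ s ⊓ mplus η ≤ η := fun hle => by
    have hmod : (η ⊔ s) ⊓ mplus η = η ⊔ s ⊓ mplus η := sup_inf_assoc_of_le s (le_of_lt hη)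
    have hplus : mplus η ≤ η ⊔ s := sInf_le (left_lt_sup.2 hsη)
    rw [inf_eq_right.2 hplus, sup_eq_left.2 hle] at hmod
    exact hη.ne' hmod
  obtain ⟨σ, hσ, hση, hσJ, hσt⟩ := exists_joinIrred_le hlow inf_le_right (le_of_lt hη)
    fun z hz hz' => le_antisymm hz' (sInf_le hz)
  have hσP : ProjIntv (jminus σ, σ) (α, β) :=
    ((Relation.EqvGen.rel _ _ hσt).trans _ _ _ ((Relation.EqvGen.rel _ _ ht).symm _ _)).trans
      _ _ _ hP
  have hσs : σ ≤ jpart α β s := le_sSup ⟨⟨hσJ, hσP⟩, hσ.trans inf_le_left⟩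
  exact hση (hσs.trans ((le_iSup₂_of_le s hs le_rfl).trans hwη))

theorem ForcesNilpotentType.gammaEl_eq_top [WellFoundedGT L] [WellFoundedLT L]
    (hL : ForcesNilpotentType L) {α β : L} (h : α ⋖ β) : GammaEl α β = ⊤ := by
  by_contra hG
  have hc := isCommutatorMult_of_join_endomorphism (jpart_sSup α β) (jpart_le α β)
    fun x y hx => jpart_le_of_not_le_gammaEl y hx
  obtain ⟨σ, -, -, hσJ, hσt⟩ := exists_joinIrred_le h.lt.not_ge le_rfl h.le
    fun z hz hz' => hz'.eq_of_not_lt (h.2 hz)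
  have hσ : σ ≤ jpart α β σ := le_sSup ⟨⟨hσJ, Relation.EqvGen.rel _ _ hσt⟩, le_rfl⟩
  obtain ⟨n, hn⟩ := hL
  have hbot := le_lowerCentralSeq_lcomm hc
    (hσ.trans (le_sup_of_le_left (le_iSup_of_le (fun h => hG (top_le_iff.1 h)) le_rfl))) n
  rw [hn] at hbot
  exact not_lt_bot (hσJ.trans_le hbot)

end ProjectiveClass

theorem forcesNilpotentType_of_gammaEl_eq_top {L : Type*} [CompleteLattice L]
    [WellFoundedGT L] [WellFoundedLT L] (h : ∀ α β : L, α ⋖ β → GammaEl α β = ⊤) :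
    ForcesNilpotentType L := by
  obtain ⟨_, ⟨n, rfl⟩, hmin⟩ :=
    wellFounded_lt.has_min (Set.range (lowerCentralSeq (lcomm : L → L → L))) ⟨_, 0, rfl⟩
  refine ⟨n, ?_⟩
  by_contra hn
  obtain ⟨α, hα, hmax⟩ := wellFounded_gt.has_min
    {α : L | α < lowerCentralSeq lcomm n} ⟨⊥, bot_lt_iff_ne_bot.2 hn⟩
  have hcov : α ⋖ lowerCentralSeq lcomm n := ⟨hα, fun z hz hz' => hmax z hz' hz⟩
  exact hmin _ ⟨n + 1, rfl⟩ ((lcomm_le_of_gammaEl_eq_top (h _ _ hcov)).trans_lt hα)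

/-- a modular lattice of finite height forces nilpotent type iff
`Γ(α,β) = 1` for every prime interval `[α,β]`. -/
theorem statement17 {L : Type*} [CompleteLattice L] [IsModularLattice L]
    (hfin : FiniteHeight L) :
    ForcesNilpotentType L ↔ ∀ α β : L, α ⋖ β → GammaEl α β = ⊤ := by
  have := hfin.wellFoundedGT
  have := hfin.wellFoundedLT
  exact ⟨fun hL _ _ => hL.gammaEl_eq_top, forcesNilpotentType_of_gammaEl_eq_top⟩
end

section
/- Let L be a bialgebraic modular lattice, let ⌊·,·⌋_L be the largest commutator operation on L, and let ⌊x : y⌋ := ⋁{ z ∈ L : ⌊z,y⌋_L ≤ x } be its associated residuation. Let η ∈ M(L). Then ⌊η : η⁺⌋ = η if and only if η is a lonesome meet irreducible element of L. -/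
namespace IsCommutatorMult

variable {L : Type*} [CompleteLattice L] {c : L → L → L}

theorem apply_sup (hc : IsCommutatorMult c) (x y z : L) : c x (y ⊔ z) = c x y ⊔ c x z := by
  have h := hc.2.2 {y, z} x
  rw [sSup_pair, iSup_pair] at h
  rw [hc.1 x, h, hc.1 y, hc.1 z]

theorem mono_right_s19 (hc : IsCommutatorMult c) (x : L) {y z : L} (h : y ≤ z) : c x y ≤ c x z := by
  rw [← sup_eq_right.2 h, hc.apply_sup]
  exact le_sup_left

theorem mono_left (hc : IsCommutatorMult c) (x : L) {y z : L} (h : y ≤ z) : c y x ≤ c z x := by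
  rw [hc.1 y, hc.1 z]
  exact hc.mono_right_s19 x h

theorem le_left (hc : IsCommutatorMult c) (x y : L) : c x y ≤ x :=
  (hc.2.1 x y).trans inf_le_left

theorem le_right (hc : IsCommutatorMult c) (x y : L) : c x y ≤ y :=
  (hc.2.1 x y).trans inf_le_right

theorem le_iff_of_transUp (hc : IsCommutatorMult c) {p q : L × L} (h : TransUp p q) (z : L) :
    c z p.2 ≤ p.1 ↔ c z q.2 ≤ q.1 := by
  obtain ⟨h₁, h₂⟩ := h
  constructor
  · intro hz
    rw [h₁, hc.apply_sup]
    exact sup_le (hz.trans (h₂.le.trans inf_le_right)) (hc.le_right _ _)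
  · intro hz
    rw [h₂]
    exact le_inf (hc.le_right _ _) ((hc.mono_right_s19 z (h₁ ▸ le_sup_left)).trans hz)

theorem le_iff_of_projIntv_s19 (hc : IsCommutatorMult c) {p q : L × L} (h : ProjIntv p q) (z : L) :
    c z p.2 ≤ p.1 ↔ c z q.2 ≤ q.1 := by
  induction h with
  | rel _ _ h => exact hc.le_iff_of_transUp h z
  | refl => rfl
  | symm _ _ _ ih => exact ih.symm
  | trans _ _ _ _ _ ih₁ ih₂ => exact ih₁.trans ih₂

theorem le_lcomm_s19 (hc : IsCommutatorMult c) (x y : L) : c x y ≤ lcomm x y :=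
  le_sSup ⟨c, hc, rfl⟩

end IsCommutatorMult

theorem isCommutatorMult_lcomm {L : Type*} [CompleteLattice L] :
    IsCommutatorMult (lcomm : L → L → L) := by
  refine ⟨fun x y => ?_, fun x y => ?_, fun S y => le_antisymm ?_ ?_⟩
  · unfold lcomm
    congr 1
    ext z
    exact ⟨fun ⟨c, hc, h⟩ => ⟨c, hc, h.trans (hc.1 x y)⟩,
      fun ⟨c, hc, h⟩ => ⟨c, hc, h.trans (hc.1 y x)⟩⟩
  · apply sSup_le
    rintro _ ⟨c, hc, rfl⟩
    exact hc.2.1 x y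
  · apply sSup_le
    rintro _ ⟨c, hc, rfl⟩
    rw [hc.2.2]
    exact iSup₂_mono fun x _ => hc.le_lcomm_s19 x y
  · refine iSup₂_le fun x hx => sSup_le ?_
    rintro _ ⟨c, hc, rfl⟩
    exact (hc.mono_left y (le_sSup hx)).trans (hc.le_lcomm_s19 _ y)

theorem MeetIrred.covBy {L : Type*} [CompleteLattice L] {η : L} (h : MeetIrred η) :
    η ⋖ mplus η :=
  ⟨h, fun _ hc hc' => (sInf_le hc).not_gt hc'⟩

theorem TransUp.trans {L : Type*} [Lattice L] {p q r : L × L} (h : TransUp p q)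
    (h' : TransUp q r) : TransUp p r := by
  obtain ⟨h₁, h₂⟩ := h
  obtain ⟨h₃, h₄⟩ := h'
  have hqr : q.1 ≤ r.1 := h₄.le.trans inf_le_right
  refine ⟨?_, ?_⟩
  · rw [h₃, h₁, sup_assoc, sup_eq_right.2 hqr]
  · rw [h₂, h₄, h₁, ← inf_assoc, inf_sup_self]

theorem TransUp.covBy_iff {L : Type*} [Lattice L] [IsModularLattice L] {p q : L × L}
    (h : TransUp p q) : p.1 ⋖ p.2 ↔ q.1 ⋖ q.2 := by
  obtain ⟨h₁, h₂⟩ := h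
  rw [h₁, h₂]
  exact ⟨fun h => covBy_sup_of_inf_covBy_left h, fun h => inf_covBy_of_covBy_sup_right h⟩

theorem CovBy.transUp {L : Type*} [Lattice L] {a b c d : L} (hab : a ⋖ b) (hcd : c ⋖ d)
    (hac : a ≤ c) (hbd : b ≤ d) (hbc : ¬ b ≤ c) : TransUp (a, b) (c, d) := by
  constructor
  · exact ((hcd.eq_or_eq (c := b ⊔ c) le_sup_right (sup_le hbd hcd.le)).resolve_left
      fun h => hbc (le_sup_left.trans h.le)).symm
  · exact ((hab.eq_or_eq (c := b ⊓ c) (le_inf hab.le hac) inf_le_left).resolve_right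
      fun h => hbc (h.ge.trans inf_le_right)).symm

/-- Above any `c ≥ a` avoiding `b`, where `a ⋖ b`, there is an element maximal avoiding `b`. -/
theorem CovBy.exists_maximal_not_le {L : Type*} [CompleteLattice L] [IsCompactlyGenerated L]
    {a b c : L} (hab : a ⋖ b) (hac : a ≤ c) (hbc : ¬ b ≤ c) :
    ∃ ψ, c ≤ ψ ∧ ¬ b ≤ ψ ∧ ∀ β, ψ < β → b ≤ β := by
  obtain ⟨k, hk, hkb, hka⟩ : ∃ k, IsCompactElement k ∧ k ≤ b ∧ ¬ k ≤ a := by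
    by_contra! h
    exact hab.lt.not_ge (le_iff_compact_le_imp.2 fun k hk => h k hk)
  have hkle {x : L} (hx : c ≤ x) (hkx : k ≤ x) : b ≤ x := by
    have : a ⊔ k = b := (hab.eq_or_eq le_sup_left (sup_le hab.le hkb)).resolve_left
      fun h => hka (le_sup_right.trans h.le)
    exact this ▸ sup_le (hac.trans hx) hkx
  obtain ⟨ψ, hcψ, hψ⟩ := zorn_le_nonempty₀ {x | c ≤ x ∧ ¬ b ≤ x} (fun S hS hchain y hy => by
    refine ⟨sSup S, ⟨(hS hy).1.trans (le_sSup hy), fun hb => ?_⟩, fun z hz => le_sSup hz⟩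
    obtain ⟨x, hx, hkx⟩ := (CompleteLattice.isCompactElement_iff_le_of_directed_sSup_le L k).1 hk
      S ⟨y, hy⟩ hchain.directedOn (hkb.trans hb)
    exact (hS hx).2 (hkle (hS hx).1 hkx)) c ⟨le_rfl, hbc⟩
  refine ⟨ψ, hcψ, hψ.prop.2, fun β hβ => ?_⟩
  by_contra h
  exact hβ.not_ge (hψ.2 ⟨hcψ.trans hβ.le, h⟩ hβ.le)

theorem CovBy.exists_meetIrred {L : Type*} [CompleteLattice L] [IsCompactlyGenerated L]
    {a b c : L} (hab : a ⋖ b) (hac : a ≤ c) (hbc : ¬ b ≤ c) :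
    ∃ ψ, c ≤ ψ ∧ MeetIrred ψ ∧ TransUp (a, b) (ψ, mplus ψ) := by
  obtain ⟨ψ, hcψ, hbψ, hψ⟩ := hab.exists_maximal_not_le hac hbc
  have hb : b ≤ mplus ψ := le_sInf fun β hβ => hψ β hβ
  have hm : MeetIrred ψ :=
    lt_of_le_of_ne (le_sInf fun _ hβ => LT.lt.le hβ) fun h => hbψ (hb.trans h.ge)
  exact ⟨ψ, hcψ, hm, hab.transUp hm.covBy (hac.trans hcψ) hb hbψ⟩

/-- Below any `x ≰ η` there is an element minimal with respect to not being below `η`. -/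
theorem MeetIrred.exists_minimal_not_le {L : Type*} [CompleteLattice L] [IsModularLattice L]
    [IsCompactlyGenerated Lᵒᵈ] {η x : L} (hη : MeetIrred η) (hx : ¬ x ≤ η) :
    ∃ ρ, ρ ≤ x ∧ ρ ≤ mplus η ∧ ¬ ρ ≤ η ∧ ∀ y, y < ρ → y ≤ η := by
  have hx' : ¬ x ⊓ mplus η ≤ η := fun h => by
    have hlt : η < x ⊔ η := lt_of_le_of_ne le_sup_right fun h' => hx (le_sup_left.trans h'.ge)
    have hle : mplus η ≤ x ⊔ η := sInf_le hlt
    have hmod : (η ⊔ x) ⊓ mplus η = η ⊔ x ⊓ mplus η := sup_inf_assoc_of_le x hη.le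
    rw [sup_eq_left.2 h, sup_comm, inf_eq_right.2 hle] at hmod
    exact hη.ne hmod.symm
  obtain ⟨ρ, h₁, h₂, h₃⟩ := hη.covBy.toDual.exists_maximal_not_le (L := Lᵒᵈ)
    (c := OrderDual.toDual (x ⊓ mplus η)) (OrderDual.toDual_le_toDual.2 inf_le_right)
    (fun h => hx' (OrderDual.toDual_le_toDual.1 h))
  have h₁' : OrderDual.ofDual ρ ≤ x ⊓ mplus η := h₁
  exact ⟨OrderDual.ofDual ρ, h₁'.trans inf_le_left, h₁'.trans inf_le_right, h₂, fun y hy => h₃ _ hy⟩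

/-- A lonesome meet irreducible element is completely prime. -/
theorem LonesomeMeet.exists_forall_not_le_iff {L : Type*} [CompleteLattice L] [IsModularLattice L]
    [IsCompactlyGenerated L] [IsCompactlyGenerated Lᵒᵈ] {η : L} (hη : LonesomeMeet η) :
    ∃ ρ, ¬ ρ ≤ η ∧ ∀ x, ¬ x ≤ η → ρ ≤ x := by
  obtain ⟨hm, hl⟩ := hη
  obtain ⟨ρ, -, hρp, hρ, hmin⟩ := hm.exists_minimal_not_le hm.not_ge
  refine ⟨ρ, hρ, fun x hx => le_trans ?_ (show x ⊓ ρ ≤ x from inf_le_left)⟩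
  by_contra hρx
  have hxρ : x ⊓ ρ ≤ η := hmin _ (lt_of_le_not_ge inf_le_right hρx)
  have hcov : ρ ⊓ η ⋖ ρ := by
    refine ⟨lt_of_le_not_ge inf_le_left fun h => hρ (h.trans inf_le_right), fun y hy hy' => ?_⟩
    exact hy.not_ge (le_inf hy'.le (hmin y hy'))
  have hnot : ¬ ρ ≤ (ρ ⊓ η) ⊔ x := fun h => by
    have hmod : ((ρ ⊓ η) ⊔ x) ⊓ ρ = (ρ ⊓ η) ⊔ x ⊓ ρ := sup_inf_assoc_of_le x inf_le_left
    rw [inf_eq_right.2 h] at hmod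
    exact hρ (hmod.le.trans (sup_le inf_le_right hxρ))
  obtain ⟨ψ, hψ, hψm, hup⟩ := hcov.exists_meetIrred le_sup_left hnot
  have hup' : TransUp (ρ ⊓ η, ρ) (η, mplus η) := hcov.transUp hm.covBy inf_le_right hρp hρ
  have : ψ = η := hl ψ hψm ((Relation.EqvGen.rel _ _ hup).symm.trans _ _ _ (.rel _ _ hup'))
  exact hx (le_sup_right.trans (this ▸ hψ))

open Classical in
/-- The commutator multiplication determined by a completely prime element. -/
theorem isCommutatorMult_ite {L : Type*} [CompleteLattice L] {η ρ : L}
    (h : ∀ x, ¬ x ≤ η → ρ ≤ x) :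
    IsCommutatorMult fun x y : L => if ¬ x ≤ η ∧ ¬ y ≤ η then ρ else ⊥ := by
  refine ⟨fun x y => by simp only [and_comm], fun x y => ?_, fun S y => le_antisymm ?_ ?_⟩
  · dsimp only
    split_ifs with hxy
    · exact le_inf (h x hxy.1) (h y hxy.2)
    · exact bot_le
  · dsimp only
    split_ifs with hxy
    · obtain ⟨x, hx, hxη⟩ : ∃ x ∈ S, ¬ x ≤ η := by
        by_contra! hS
        exact hxy.1 (sSup_le hS)
      exact le_iSup₂_of_le x hx (if_pos (c := ¬ x ≤ η ∧ ¬ y ≤ η) ⟨hxη, hxy.2⟩).ge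
    · exact bot_le
  · refine iSup₂_le fun x hx => ?_
    dsimp only
    by_cases hxy : ¬ x ≤ η ∧ ¬ y ≤ η
    · rw [if_pos hxy, if_pos ⟨fun hS => hxy.1 ((le_sSup hx).trans hS), hxy.2⟩]
    · rw [if_neg hxy]
      exact bot_le

theorem lonesomeMeet_of_forall_le {L : Type*} [CompleteLattice L] [IsModularLattice L]
    [IsCompactlyGenerated L] {η : L} (hη : MeetIrred η)
    (h : ∀ φ, MeetIrred φ → ProjIntv (φ, mplus φ) (η, mplus η) → φ ≤ η) : LonesomeMeet η := by
  have step {p q : L × L} (hpq : TransUp p q) :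
      TransUp p (η, mplus η) ↔ TransUp q (η, mplus η) := by
    refine ⟨fun hp => ?_, fun hq => hpq.trans hq⟩
    have hq : q.1 ⋖ q.2 := hpq.covBy_iff.1 (hp.covBy_iff.2 hη.covBy)
    obtain ⟨ψ, -, hψm, hqψ⟩ := hq.exists_meetIrred le_rfl hq.lt.not_ge
    have hpψ := hpq.trans hqψ
    have hle : ψ ≤ η := h ψ hψm ((Relation.EqvGen.rel _ _ hpψ).symm.trans _ _ _ (.rel _ _ hp))
    rcases hle.eq_or_lt with rfl | hlt
    · exact hqψ
    · have hp2 : p.2 ≤ η := (le_sup_left.trans hpψ.1.ge).trans (sInf_le hlt)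
      exact absurd (hp.2.trans (inf_eq_left.2 hp2)) (hp.covBy_iff.2 hη.covBy).ne
  have key {p q : L × L} (hpq : ProjIntv p q) :
      TransUp p (η, mplus η) ↔ TransUp q (η, mplus η) := by
    induction hpq with
    | rel _ _ h => exact step h
    | refl => rfl
    | symm _ _ _ ih => exact ih.symm
    | trans _ _ _ _ _ ih₁ ih₂ => exact ih₁.trans ih₂
  refine ⟨hη, fun φ hφ hproj => ?_⟩
  have hup : TransUp (φ, mplus φ) (η, mplus η) :=
    (key hproj).2 ⟨(sup_eq_left.2 hη.le).symm, (inf_eq_right.2 hη.le).symm⟩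
  refine (h φ hφ hproj).eq_or_lt.resolve_right fun hlt => hφ.ne ?_
  exact hup.2.trans (inf_eq_left.2 (sInf_le hlt))

/-- in a bialgebraic modular lattice, `⌊η : η⁺⌋ = η` iff `η` is a
lonesome meet irreducible element. -/
theorem statement19 {L : Type*} [CompleteLattice L] [IsModularLattice L]
    [IsCompactlyGenerated L] [IsCompactlyGenerated Lᵒᵈ]
    (η : L) (hη : MeetIrred η) :
    sSup {z : L | lcomm z (mplus η) ≤ η} = η ↔ LonesomeMeet η := by
  have hc : IsCommutatorMult (lcomm : L → L → L) := isCommutatorMult_lcomm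
  constructor
  · intro h
    refine lonesomeMeet_of_forall_le hη fun φ _ hproj => ?_
    have hφ : lcomm φ (mplus η) ≤ η := (hc.le_iff_of_projIntv_s19 hproj φ).1 (hc.le_left _ _)
    exact (le_sSup (a := φ) hφ).trans h.le
  · intro h
    obtain ⟨ρ, hρ, hle⟩ := h.exists_forall_not_le_iff
    refine le_antisymm (sSup_le fun z hz => ?_) (le_sSup (hc.le_left _ _))
    by_contra hzη
    have hρz := (isCommutatorMult_ite hle).le_lcomm_s19 z (mplus η)
    rw [if_pos ⟨hzη, hη.not_ge⟩] at hρz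
    exact hρ (hρz.trans hz)
end
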